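/- arXiv:1309.3447 — 4 statements merged into one kernel-verified Lean document; each statement's English description precedes it below -/
import Mathlib

section
/- Let z ∈ ℂ with z ≠ 0. Then the matrix 𝒵(z)U is invertible and (𝒵(z)U)^{−1} Λ(z⁴) 𝒵(z)U = iz·ω, i.e. the companion matrix Λ(z⁴) is diagonalized by 𝒵(z)U with eigenvalues izω₁, izω₂, izω₃, izω₄. Moreover U is a unitary 4×4 matrix. -/
open Complex Matrix

/-- `ω = diag(i, 1, −1, −i)`. -/
noncomputable def omegaMat : Matrix (Fin 4) (Fin 4) ℂ :=
  Matrix.diagonal ![Complex.I, 1, -1, -Complex.I]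

/-- The unitary matrix `U` with entries `U_{jk} = ω_k^{j−1}/2`. -/
noncomputable def Umat : Matrix (Fin 4) (Fin 4) ℂ :=
  (1 / 2 : ℂ) • !![1, 1, 1, 1;
                   Complex.I, 1, -1, -Complex.I;
                   -1, 1, 1, -1;
                   -Complex.I, 1, -1, Complex.I]

/-- `𝒵(z) = diag(1, iz, (iz)², (iz)³)`. -/
noncomputable def Zmat (z : ℂ) : Matrix (Fin 4) (Fin 4) ℂ :=
  Matrix.diagonal ![1, Complex.I * z, (Complex.I * z) ^ 2, (Complex.I * z) ^ 3]

/-- The companion matrix `Λ(λ)`. -/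
def LamMat (lam : ℂ) : Matrix (Fin 4) (Fin 4) ℂ :=
  !![0, 1, 0, 0;
     0, 0, 1, 0;
     0, 0, 0, 1;
     lam, 0, 0, 0]

theorem Umat_mem_unitaryGroup : Umat ∈ Matrix.unitaryGroup (Fin 4) ℂ := by
  rw [Matrix.mem_unitaryGroup_iff]
  have hI := Complex.I_sq
  have h2 : (starRingEnd ℂ) 2 = 2 := Complex.conj_ofNat 2
  ext j k
  fin_cases j <;> fin_cases k <;>
    simp [Umat, Matrix.mul_apply, Fin.sum_univ_four, Matrix.star_apply, h2] <;>
    grind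

theorem isUnit_Zmat {z : ℂ} (hz : z ≠ 0) : IsUnit (Zmat z) := by
  rw [Matrix.isUnit_iff_isUnit_det]
  simp [Zmat, Matrix.det_diagonal, Fin.prod_univ_four, hz]

theorem LamMat_mul_Zmat_mul_Umat (z : ℂ) :
    LamMat (z ^ 4) * (Zmat z * Umat) = Zmat z * Umat * ((Complex.I * z) • omegaMat) := by
  have hI := Complex.I_sq
  ext j k
  fin_cases j <;> fin_cases k <;>
    simp [LamMat, Zmat, Umat, omegaMat, Matrix.mul_apply, Fin.sum_univ_four,
      Matrix.diagonal_apply] <;>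
    grind

/-- For `z ≠ 0` the matrix `𝒵(z)U` is invertible and diagonalizes the companion matrix:
`(𝒵(z)U)⁻¹ Λ(z⁴) 𝒵(z)U = iz·ω`; moreover `U` is unitary. -/
theorem companion_diagonalization (z : ℂ) (hz : z ≠ 0) :
    IsUnit (Zmat z * Umat) ∧
    (Zmat z * Umat)⁻¹ * LamMat (z ^ 4) * (Zmat z * Umat) = (Complex.I * z) • omegaMat ∧
    Umat ∈ Matrix.unitaryGroup (Fin 4) ℂ := by
  have hU := Umat_mem_unitaryGroup
  have hZU : IsUnit (Zmat z * Umat) :=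
    (isUnit_Zmat hz).mul (Unitary.isUnit_coe (U := ⟨Umat, hU⟩))
  refine ⟨hZU, ?_, hU⟩
  rw [Matrix.mul_assoc, LamMat_mul_Zmat_mul_Umat,
    Matrix.nonsing_inv_mul_cancel_left _ _ ((Matrix.isUnit_iff_isUnit_det _).mp hZU)]
end

section
/- Let z ∈ ℂ with z ≠ 0 and let p, q ∈ ℂ. Then −(𝒵(z)U)^{−1}(2pJ + qJ₁)𝒵(z)U = (2ip/z)A + (iq/z³)A₁, where A = U^{−1}JU = (1/4)·[[−i,−1,1,i],[i,1,−1,−i],[i,1,−1,−i],[−i,−1,1,i]] and A₁ = −U^{−1}J₁U = (1/4)·[[−i,−i,−i,−i],[−1,−1,−1,−1],[1,1,1,1],[i,i,i,i]]. -/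
open Complex Matrix

/-- `J` has `J₃₂ = 1` and all other entries `0`. -/
def Jmat : Matrix (Fin 4) (Fin 4) ℂ :=
  !![0, 0, 0, 0;
     0, 0, 0, 0;
     0, 1, 0, 0;
     0, 0, 0, 0]

/-- `J₁` has `(J₁)₄₁ = 1` and all other entries `0`. -/
def J1mat : Matrix (Fin 4) (Fin 4) ℂ :=
  !![0, 0, 0, 0;
     0, 0, 0, 0;
     0, 0, 0, 0;
     1, 0, 0, 0]

/-- `A = U⁻¹JU`. -/
noncomputable def Amat : Matrix (Fin 4) (Fin 4) ℂ :=
  (1 / 4 : ℂ) • !![-Complex.I, -1, 1, Complex.I;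
                   Complex.I, 1, -1, -Complex.I;
                   Complex.I, 1, -1, -Complex.I;
                   -Complex.I, -1, 1, Complex.I]

/-- `A₁ = −U⁻¹J₁U`. -/
noncomputable def A1mat : Matrix (Fin 4) (Fin 4) ℂ :=
  (1 / 4 : ℂ) • !![-Complex.I, -Complex.I, -Complex.I, -Complex.I;
                   -1, -1, -1, -1;
                   1, 1, 1, 1;
                   Complex.I, Complex.I, Complex.I, Complex.I]

theorem isUnit_det_Umat : IsUnit Umat.det := by
  refine Matrix.isUnit_det_of_right_inverse (B := Umatᴴ) ?_
  ext j k
  fin_cases j <;> fin_cases k <;>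
    simp [Umat, Matrix.mul_apply, Fin.sum_univ_four, Complex.conj_ofNat] <;>
    ring_nf <;> simp <;> norm_num

theorem isUnit_det_Zmat {z : ℂ} (hz : z ≠ 0) : IsUnit (Zmat z).det := by
  simp [Zmat, Matrix.det_diagonal, Fin.prod_univ_four, hz]

/-- Conjugation by `𝒵(z)` rescales the matrix unit `J`. -/
theorem Jmat_mul_Zmat {z : ℂ} (hz : z ≠ 0) : Jmat * Zmat z = Zmat z * ((-I / z) • Jmat) := by
  ext j k
  fin_cases j <;> fin_cases k <;> simp [Jmat, Zmat, mul_pow]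
  field_simp

/-- Conjugation by `𝒵(z)` rescales the matrix unit `J₁`. -/
theorem J1mat_mul_Zmat {z : ℂ} (hz : z ≠ 0) :
    J1mat * Zmat z = Zmat z * ((I / z ^ 3) • J1mat) := by
  ext j k
  fin_cases j <;> fin_cases k <;> simp [J1mat, Zmat, mul_pow, I_pow_three]
  field_simp
  simp

theorem Umat_mul_Amat : Umat * Amat = Jmat * Umat := by
  ext j k
  fin_cases j <;> fin_cases k <;>
    simp [Umat, Amat, Jmat, Matrix.mul_apply, Fin.sum_univ_four] <;>
    ring_nf

theorem Umat_mul_A1mat : Umat * A1mat = -(J1mat * Umat) := by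
  ext j k
  fin_cases j <;> fin_cases k <;>
    simp [Umat, A1mat, J1mat, Matrix.mul_apply, Fin.sum_univ_four] <;>
    ring_nf <;> simp <;> norm_num

/-- For `z ≠ 0` and `p, q ∈ ℂ`:
`−(𝒵(z)U)⁻¹(2pJ + qJ₁)𝒵(z)U = (2ip/z)A + (iq/z³)A₁`, where `A = U⁻¹JU` and
`A₁ = −U⁻¹J₁U`. -/
theorem conjugated_perturbation (z : ℂ) (hz : z ≠ 0) (p q : ℂ) :
    -((Zmat z * Umat)⁻¹ * ((2 * p) • Jmat + q • J1mat) * (Zmat z * Umat))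
      = (2 * Complex.I * p / z) • Amat + (Complex.I * q / z ^ 3) • A1mat ∧
    Amat = Umat⁻¹ * Jmat * Umat ∧
    A1mat = -(Umat⁻¹ * J1mat * Umat) := by
  have hA : Amat = Umat⁻¹ * Jmat * Umat := by
    rw [Matrix.mul_assoc, ← Umat_mul_Amat,
      Matrix.nonsing_inv_mul_cancel_left _ _ isUnit_det_Umat]
  have hA1 : A1mat = -(Umat⁻¹ * J1mat * Umat) := by
    rw [Matrix.mul_assoc, ← Matrix.mul_neg, ← Umat_mul_A1mat,
      Matrix.nonsing_inv_mul_cancel_left _ _ isUnit_det_Umat]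
  refine ⟨?_, hA, hA1⟩
  have hconj : ((2 * p) • Jmat + q • J1mat) * (Zmat z * Umat)
      = Zmat z * (((2 * p * (-I / z)) • Jmat + (q * (I / z ^ 3)) • J1mat) * Umat) := by
    simp only [← Matrix.mul_assoc, Matrix.add_mul, Matrix.mul_add, Matrix.smul_mul,
      Matrix.mul_smul, Jmat_mul_Zmat hz, J1mat_mul_Zmat hz, smul_smul]
  rw [Matrix.mul_assoc, hconj, Matrix.mul_inv_rev, Matrix.mul_assoc,
    Matrix.nonsing_inv_mul_cancel_left _ _ (isUnit_det_Zmat hz), hA, hA1]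
  simp only [Matrix.add_mul, Matrix.mul_add, Matrix.smul_mul, Matrix.mul_smul, Matrix.mul_assoc]
  module
end

section
/- Let V ∈ L¹((0,1); ℂ), let p₀ ∈ ℝ, and let (εₙ) be a sequence of real numbers with εₙ → 0. Define zₙ = πn − (p₀ + εₙ)/(2πn) for n ≥ 1. Then, as n → ∞, ∫₀¹ e^{2izₙ(1−s)} V(s) ds = V̂ₙ + o(1/n), where V̂ₙ = ∫₀¹ e^{−2πins} V(s) ds; that is, n·(∫₀¹ e^{2izₙ(1−s)} V(s) ds − V̂ₙ) → 0. -/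
open Complex Filter MeasureTheory intervalIntegral

/-- If `aₙ → a`, then `n (exp (aₙ / n) - 1) → a`. -/
theorem tendsto_natCast_mul_exp_div_sub_one {a : ℕ → ℂ} {l : ℂ}
    (ha : Tendsto a atTop (nhds l)) :
    Tendsto (fun n : ℕ => (n : ℂ) * (Complex.exp (a n / n) - 1)) atTop (nhds l) := by
  have hquot : Tendsto (fun n : ℕ => a n / (n : ℂ)) atTop (nhds 0) := by
    simpa [div_eq_mul_inv] using ha.mul (tendsto_inv_atTop_nhds_zero_nat (𝕜 := ℂ))
  have hcont : ContinuousAt (dslope Complex.exp 0) 0 :=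
    continuousAt_dslope_same.2 Complex.differentiableAt_exp
  have hslope := ha.mul (hcont.tendsto.comp hquot)
  rw [dslope_same, (Complex.hasDerivAt_exp 0).deriv, Complex.exp_zero, mul_one] at hslope
  refine hslope.congr' ?_
  filter_upwards [eventually_ne_atTop 0] with n hn
  have hn' : (n : ℂ) ≠ 0 := Nat.cast_ne_zero.2 hn
  have h := sub_smul_dslope Complex.exp 0 (a n / (n : ℂ))
  rw [sub_zero, smul_eq_mul, Complex.exp_zero] at h
  rw [← h, Function.comp_apply, ← mul_assoc, mul_div_cancel₀ _ hn']

/-- The Riemann–Lebesgue lemma for Fourier coefficients on the unit interval. -/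
theorem tendsto_integral_unitInterval_exp_mul (f : ℝ → ℂ) :
    Tendsto (fun n : ℕ =>
      ∫ s in (0:ℝ)..1, Complex.exp (-(2 * Real.pi * n * s : ℝ) * Complex.I) * f s)
      atTop (nhds 0) := by
  have hatTop : Tendsto (fun n : ℕ => (n : ℝ)) atTop (cocompact ℝ) :=
    tendsto_natCast_atTop_atTop.mono_right atTop_le_cocompact
  refine ((Real.tendsto_integral_exp_smul_cocompact
    ((Set.Ioc (0:ℝ) 1).indicator f)).comp hatTop).congr fun n => ?_
  rw [intervalIntegral.integral_of_le zero_le_one,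
    ← MeasureTheory.integral_indicator measurableSet_Ioc]
  refine integral_congr_ae (Eventually.of_forall fun s => ?_)
  by_cases hs : s ∈ Set.Ioc (0:ℝ) 1
  · simp only [Set.indicator_of_mem hs, Circle.smul_def, Real.fourierChar_apply, smul_eq_mul]
    congr 2
    push_cast
    ring
  · simp [Set.indicator_of_notMem hs]

/-- The phase `2 i zₙ (1 - s)` with `zₙ = πn - q / (2πn)` factors through `e^{-2πins}`. -/
theorem exp_perturbed_phase {n : ℕ} (hn : n ≠ 0) (q s : ℝ) :
    Complex.exp (2 * Complex.I * ((Real.pi * n - q / (2 * Real.pi * n) : ℝ) : ℂ) * (1 - s)) =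
      Complex.exp (-(2 * Real.pi * n * s : ℝ) * Complex.I) *
        Complex.exp (Complex.I * ((-(q / Real.pi) * (1 - s) : ℝ) : ℂ) / n) := by
  have hn' : (n : ℂ) ≠ 0 := Nat.cast_ne_zero.2 hn
  have hpi : (Real.pi : ℂ) ≠ 0 := Complex.ofReal_ne_zero.2 Real.pi_ne_zero
  rw [← Complex.exp_add, Complex.exp_eq_exp_iff_exists_int]
  refine ⟨n, ?_⟩
  push_cast
  field_simp
  ring

/-- `‖n (exp (i x / n) - 1)‖ ≤ |x|` for real `x`. -/
theorem norm_natCast_mul_exp_I_mul_div_sub_one_le (n : ℕ) (x : ℝ) :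
    ‖(n : ℂ) * (Complex.exp (Complex.I * (x : ℂ) / n) - 1)‖ ≤ |x| := by
  rcases eq_or_ne n 0 with rfl | hn
  · simp
  have hn' : (0 : ℝ) < n := Nat.cast_pos.2 (Nat.pos_of_ne_zero hn)
  have h := Real.norm_exp_I_mul_ofReal_sub_one_le (x := x / n)
  rw [Complex.ofReal_div, Complex.ofReal_natCast, ← mul_div_assoc, Real.norm_eq_abs, abs_div,
    abs_of_pos hn', le_div_iff₀ hn'] at h
  rwa [norm_mul, Complex.norm_natCast, mul_comm]

/-- Let `V ∈ L¹((0,1); ℂ)`, `p₀ ∈ ℝ`, and `εₙ → 0` real. With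
`zₙ = πn − (p₀ + εₙ)/(2πn)`, one has `∫₀¹ e^{2izₙ(1−s)} V(s) ds = V̂ₙ + o(1/n)` as
`n → ∞`, where `V̂ₙ = ∫₀¹ e^{−2πins} V(s) ds`. -/
theorem oscillatory_integral_asymptotics (V : ℝ → ℂ)
    (hV : IntervalIntegrable V MeasureTheory.volume 0 1) (p₀ : ℝ) (ε : ℕ → ℝ)
    (hε : Tendsto ε atTop (nhds 0)) :
    Tendsto (fun n : ℕ =>
      (n : ℂ) * ((∫ s in (0:ℝ)..1,
          Complex.exp (2 * Complex.I *
            ((Real.pi * n - (p₀ + ε n) / (2 * Real.pi * n) : ℝ) : ℂ) * (1 - s)) * V s)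
        - ∫ s in (0:ℝ)..1, Complex.exp (-(2 * Real.pi * n * s : ℝ) * Complex.I) * V s))
      atTop (nhds 0) := by
  set e : ℕ → ℝ → ℂ := fun n s => Complex.exp (-(2 * Real.pi * n * s : ℝ) * Complex.I) with he
  set x : ℕ → ℝ → ℝ := fun n s => -((p₀ + ε n) / Real.pi) * (1 - s) with hx
  set g : ℕ → ℝ → ℂ := fun n s =>
    (n : ℂ) * (Complex.exp (Complex.I * (x n s : ℂ) / n) - 1) with hg
  set g₀ : ℝ → ℂ := fun s => Complex.I * ((-(p₀ / Real.pi) * (1 - s) : ℝ) : ℂ)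
  have he_norm (n : ℕ) (s : ℝ) : ‖e n s‖ = 1 := by
    have h := Complex.norm_exp_ofReal_mul_I (-(2 * Real.pi * n * s))
    rwa [Complex.ofReal_neg] at h
  have he_cont (n : ℕ) : Continuous (e n) := by fun_prop
  have hg_cont (n : ℕ) : Continuous (g n) := by fun_prop
  have hg₀_cont : Continuous g₀ := by fun_prop
  have hp : Tendsto (fun n => p₀ + ε n) atTop (nhds p₀) := by
    simpa using hε.const_add p₀
  have hg_tendsto (s : ℝ) : Tendsto (fun n => g n s) atTop (nhds (g₀ s)) := by
    refine tendsto_natCast_mul_exp_div_sub_one (Tendsto.const_mul _ ?_)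
    exact (Complex.continuous_ofReal.tendsto _).comp
      (((hp.div_const _).neg).mul_const _)
  obtain ⟨C, hC⟩ := hp.norm.bddAbove_range
  have hC' (n : ℕ) : |p₀ + ε n| ≤ C := hC ⟨n, rfl⟩
  have hg_bound (n : ℕ) (s : ℝ) (hs : s ∈ Set.Ioc (0:ℝ) 1) : ‖g n s‖ ≤ C / Real.pi := by
    refine (norm_natCast_mul_exp_I_mul_div_sub_one_le n _).trans ?_
    rw [hx, abs_mul, abs_neg, abs_div, abs_of_pos Real.pi_pos]
    have h1 : |1 - s| ≤ 1 := abs_le.2 ⟨by linarith [hs.2], by linarith [hs.1]⟩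
    calc |p₀ + ε n| / Real.pi * |1 - s| ≤ |p₀ + ε n| / Real.pi :=
          mul_le_of_le_one_right (by positivity) h1
      _ ≤ C / Real.pi := by gcongr; exact hC' n
  have hg₀_bound (s : ℝ) (hs : s ∈ Set.Ioc (0:ℝ) 1) : ‖g₀ s‖ ≤ C / Real.pi :=
    le_of_tendsto (hg_tendsto s).norm (Eventually.of_forall fun n => hg_bound n s hs)
  have hrem : Tendsto (fun n => ∫ s in (0:ℝ)..1, e n s * (g n s - g₀ s) * V s) atTop
      (nhds 0) := by
    have h := tendsto_integral_filter_of_dominated_convergence (μ := volume) (a := 0) (b := 1)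
      (l := atTop) (F := fun n s => e n s * (g n s - g₀ s) * V s) (f := fun _ => (0 : ℂ))
      (fun s => (C / Real.pi + C / Real.pi) * ‖V s‖) ?_ ?_ (hV.norm.const_mul _) ?_
    · simpa using h
    · refine Eventually.of_forall fun n => ?_
      exact ((he_cont n).mul ((hg_cont n).sub hg₀_cont)).aestronglyMeasurable.mul
        hV.def'.aestronglyMeasurable
    · refine Eventually.of_forall fun n => Eventually.of_forall fun s hs => ?_
      rw [Set.uIoc_of_le zero_le_one] at hs
      rw [norm_mul, norm_mul, he_norm, one_mul]
      gcongr
      exact (norm_sub_le _ _).trans (add_le_add (hg_bound n s hs) (hg₀_bound s hs))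
    · refine Eventually.of_forall fun s _ => ?_
      have hsub : Tendsto (fun n => g n s - g₀ s) atTop (nhds 0) := by
        simpa using (hg_tendsto s).sub_const (g₀ s)
      have hprod : Tendsto (fun n => e n s * (g n s - g₀ s)) atTop (nhds 0) := by
        rw [tendsto_zero_iff_norm_tendsto_zero] at hsub ⊢
        simpa [he_norm] using hsub
      simpa using hprod.mul_const (V s)
  have hmain := hrem.add (tendsto_integral_unitInterval_exp_mul fun s => g₀ s * V s)
  rw [add_zero] at hmain
  refine hmain.congr' ?_
  filter_upwards [eventually_ne_atTop 0] with n hn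
  have h_integrable {k : ℝ → ℂ} (hk : Continuous k) :
      IntervalIntegrable (fun s => k s * V s) volume 0 1 :=
    hV.continuousOn_mul hk.continuousOn
  simp_rw [exp_perturbed_phase hn]
  rw [← intervalIntegral.integral_sub, ← intervalIntegral.integral_const_mul,
    ← intervalIntegral.integral_add]
  · refine intervalIntegral.integral_congr fun s _ => ?_
    simp only [he, hg, hx]
    ring
  · exact h_integrable ((he_cont n).mul ((hg_cont n).sub hg₀_cont))
  · exact (h_integrable ((he_cont n).mul hg₀_cont)).congr fun s _ => mul_assoc (e n s) (g₀ s) (V s)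
  · exact h_integrable (by fun_prop)
  · exact h_integrable (he_cont n)
end

section
/- Let p, q : ℝ → ℝ be continuous and 1-periodic, with p continuously differentiable, and let λ ∈ ℂ. Then there exists a nonzero four times continuously differentiable function f : ℝ → ℂ satisfying f'''' + 2(p f')' + q f = λ f on ℝ and f(t + 2) = f(t) for all t ∈ ℝ, if and only if det(M(1, λ) − I₄)·det(M(1, λ) + I₄) = 0. -/
open Complex Matrix

/-- Solutions of a linear system `y' = A(t) y` with continuous coefficients are determined by
their value at one time. -/
theorem linearODE_unique {n : Type*} [Fintype n] {A : ℝ → Matrix n n ℂ}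
    (hA : Continuous A) {y z : ℝ → n → ℂ} {t₀ : ℝ}
    (hy : ∀ t, HasDerivAt y (A t *ᵥ y t) t) (hz : ∀ t, HasDerivAt z (A t *ᵥ z t) t)
    (h : y t₀ = z t₀) : y = z := by
  let := Matrix.linftyOpNormedAddCommGroup (m := n) (n := n) (α := ℂ)
  funext t
  obtain ⟨a, b, ht, ht₀⟩ : ∃ a b, t ∈ Set.Ioo a b ∧ t₀ ∈ Set.Ioo a b := by
    refine ⟨min t t₀ - 1, max t t₀ + 1, ?_⟩
    grind
  obtain ⟨C, hC⟩ := (isCompact_Icc (a := a) (b := b)).exists_bound_of_continuousOn hA.continuousOn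
  refine ODE_solution_unique_of_mem_Ioo (v := fun t x => A t *ᵥ x) (s := fun _ => Set.univ)
    (K := C.toNNReal) (fun s hs => ?_) ht₀ (fun s _ => ⟨hy s, trivial⟩)
    (fun s _ => ⟨hz s, trivial⟩) h ht
  refine (LipschitzWith.of_dist_le_mul fun x x' => ?_).lipschitzOnWith
  rw [dist_eq_norm, dist_eq_norm, ← Matrix.mulVec_sub]
  refine (Matrix.linfty_opNorm_mulVec _ _).trans ?_
  gcongr
  exact (hC s (Set.Ioo_subset_Icc_self hs)).trans (Real.le_coe_toNNReal C)

/-- The coefficient matrix `Λ(λ) − 2pJ − qJ₁` of the first order system. -/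
noncomputable def coeffMat (p q : ℝ → ℝ) (lam : ℂ) (t : ℝ) : Matrix (Fin 4) (Fin 4) ℂ :=
  LamMat lam - (2 * p t : ℝ) • Jmat - (q t : ℝ) • J1mat

theorem coeffMat_mulVec (p q : ℝ → ℝ) (lam : ℂ) (t : ℝ) (y : Fin 4 → ℂ) :
    coeffMat p q lam t *ᵥ y =
      ![y 1, y 2, y 3 - 2 * (p t : ℂ) * y 1, (lam - (q t : ℂ)) * y 0] := by
  ext i
  fin_cases i <;>
    simp [coeffMat, LamMat, Jmat, J1mat, Matrix.mulVec, dotProduct, Fin.sum_univ_four]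
  ring

theorem continuous_coeffMat {p q : ℝ → ℝ} (hp : Continuous p) (hq : Continuous q) (lam : ℂ) :
    Continuous (coeffMat p q lam) := by
  unfold coeffMat
  fun_prop

/-- The system `y' = (Λ(λ) − 2pJ − qJ₁) y` written in coordinates. -/
theorem hasDerivAt_coeffMat_iff {p q : ℝ → ℝ} {lam : ℂ} {y : ℝ → Fin 4 → ℂ} {t : ℝ} :
    HasDerivAt y (coeffMat p q lam t *ᵥ y t) t ↔
      HasDerivAt (fun s => y s 0) (y t 1) t ∧ HasDerivAt (fun s => y s 1) (y t 2) t ∧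
      HasDerivAt (fun s => y s 2) (y t 3 - 2 * (p t : ℂ) * y t 1) t ∧
      HasDerivAt (fun s => y s 3) ((lam - (q t : ℂ)) * y t 0) t := by
  rw [hasDerivAt_pi, coeffMat_mulVec]
  simp [Fin.forall_fin_succ]

theorem hasDerivAt_mulVec_of_entries {n : Type*} [Fintype n] {M : ℝ → Matrix n n ℂ}
    {A : Matrix n n ℂ} {t : ℝ}
    (hM : ∀ i j, HasDerivAt (fun s => M s i j) ((A * M t) i j) t) (v : n → ℂ) :
    HasDerivAt (fun s => M s *ᵥ v) (A *ᵥ (M t *ᵥ v)) t := by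
  rw [hasDerivAt_pi]
  intro i
  rw [Matrix.mulVec_mulVec]
  simp only [Matrix.mulVec, dotProduct]
  exact HasDerivAt.fun_sum fun j _ => (hM i j).mul_const (v j)

theorem contDiff_succ_of_hasDerivAt {f g : ℝ → ℂ} {n : ℕ} (h : ∀ t, HasDerivAt f (g t) t)
    (hg : ContDiff ℝ n g) : ContDiff ℝ (n + 1 : ℕ) f := by
  push_cast
  refine contDiff_succ_iff_deriv.2 ⟨fun t => (h t).differentiableAt, by simp, ?_⟩
  rwa [show deriv f = g from funext fun t => (h t).deriv]

theorem periodic_deriv {f : ℝ → ℂ} {c : ℝ} (h : ∀ t, f (t + c) = f t) (t : ℝ) :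
    deriv f (t + c) = deriv f t := by
  rw [← deriv_comp_add_const, funext h]

theorem det_sub_one_mul_det_add_one_eq_zero_iff {n : Type*} [Fintype n] [DecidableEq n]
    (B : Matrix n n ℂ) :
    (B - 1).det * (B + 1).det = 0 ↔ ∃ v ≠ 0, B *ᵥ (B *ᵥ v) = v := by
  rw [← Matrix.det_mul, ← Matrix.exists_mulVec_eq_zero_iff]
  have h : (B - 1) * (B + 1) = B * B - 1 := by noncomm_ring
  simp [h, Matrix.sub_mulVec, sub_eq_zero]

/-- The vector `(f, f', f'', f''' + 2pf')` of quasi-derivatives of `f`. -/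
noncomputable def quasiDeriv (p : ℝ → ℝ) (f : ℝ → ℂ) (t : ℝ) : Fin 4 → ℂ :=
  ![f t, deriv f t, deriv (deriv f) t,
    deriv (deriv (deriv f)) t + 2 * ((p t : ℂ) * deriv f t)]

/-- The quasi-derivative vector of a solution of
`f'''' + 2(pf')' + qf = λf` solves the first order system. -/
theorem hasDerivAt_quasiDeriv {p q : ℝ → ℝ} (hp : ContDiff ℝ 1 p) {lam : ℂ} {f : ℝ → ℂ}
    (hf : ContDiff ℝ 4 f)
    (heq : ∀ t : ℝ, iteratedDeriv 4 f t + 2 * deriv (fun s => (p s : ℂ) * deriv f s) t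
      + (q t : ℂ) * f t = lam * f t) (t : ℝ) :
    HasDerivAt (quasiDeriv p f) (coeffMat p q lam t *ᵥ quasiDeriv p f t) t := by
  have d1 : ContDiff ℝ 3 (deriv f) := (contDiff_succ_iff_deriv (n := 3).1 hf).2.2
  have d2 : ContDiff ℝ 2 (deriv (deriv f)) := (contDiff_succ_iff_deriv (n := 2).1 d1).2.2
  have d3 : ContDiff ℝ 1 (deriv (deriv (deriv f))) :=
    (contDiff_succ_iff_deriv (n := 1).1 d2).2.2
  have hpf : Differentiable ℝ fun s => (p s : ℂ) * deriv f s :=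
    (ofRealCLM.differentiable.comp (hp.differentiable one_ne_zero)).mul
      (d1.differentiable (by norm_num))
  rw [hasDerivAt_coeffMat_iff]
  refine ⟨(hf.differentiable (by norm_num) t).hasDerivAt,
    (d1.differentiable (by norm_num) t).hasDerivAt, ?_, ?_⟩
  · refine (d2.differentiable (by norm_num) t).hasDerivAt.congr_deriv ?_
    simp [quasiDeriv]
    ring
  · refine ((d3.differentiable (by norm_num) t).hasDerivAt.add
      ((hpf t).hasDerivAt.const_mul 2)).congr_deriv ?_
    have := heq t
    simp only [iteratedDeriv_succ, iteratedDeriv_zero] at this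
    simp only [quasiDeriv, Matrix.cons_val_zero]
    linear_combination this

/-- The first component of a solution of the first order system is four times continuously
differentiable and solves `f'''' + 2(pf')' + qf = λf`. -/
theorem solution_of_hasDerivAt_coeffMat {p q : ℝ → ℝ} (hp : ContDiff ℝ 1 p) (hq : Continuous q)
    {lam : ℂ} {y : ℝ → Fin 4 → ℂ} (hy : ∀ t, HasDerivAt y (coeffMat p q lam t *ᵥ y t) t) :
    ContDiff ℝ 4 (fun t => y t 0) ∧
      ∀ t : ℝ, iteratedDeriv 4 (fun t => y t 0) t
        + 2 * deriv (fun s => (p s : ℂ) * deriv (fun t => y t 0) s) t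
        + (q t : ℂ) * y t 0 = lam * y t 0 := by
  simp only [hasDerivAt_coeffMat_iff, forall_and] at hy
  obtain ⟨h0, h1, h2, h3⟩ := hy
  have hpC : ContDiff ℝ 1 fun s => (p s : ℂ) := ofRealCLM.contDiff.comp hp
  have c0 : Continuous fun s => y s 0 :=
    continuous_iff_continuousAt.2 fun t => (h0 t).continuousAt
  have c2 : Continuous fun s => y s 2 :=
    continuous_iff_continuousAt.2 fun t => (h2 t).continuousAt
  have k3 : ContDiff ℝ 1 fun s => y s 3 := by
    refine mod_cast contDiff_succ_of_hasDerivAt (n := 0) h3 (contDiff_zero.2 ?_)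
    fun_prop
  have k1 : ContDiff ℝ 1 fun s => y s 1 :=
    mod_cast contDiff_succ_of_hasDerivAt (n := 0) h1 (contDiff_zero.2 c2)
  have k : ContDiff ℝ 1 fun s => y s 3 - 2 * (p s : ℂ) * y s 1 :=
    k3.sub ((contDiff_const.mul hpC).mul k1)
  refine ⟨mod_cast contDiff_succ_of_hasDerivAt (n := 3) h0
    (contDiff_succ_of_hasDerivAt (n := 2) h1
      (contDiff_succ_of_hasDerivAt (n := 1) h2 (mod_cast k))), fun t => ?_⟩
  have e0 : deriv (fun s => y s 0) = fun s => y s 1 := funext fun t => (h0 t).deriv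
  have e1 : deriv (fun s => y s 1) = fun s => y s 2 := funext fun t => (h1 t).deriv
  have e2 : deriv (fun s => y s 2) = fun s => y s 3 - 2 * (p s : ℂ) * y s 1 :=
    funext fun t => (h2 t).deriv
  have hpy := (((hpC.mul k1).differentiable one_ne_zero) t).hasDerivAt
  have e3 : deriv (fun s => y s 3 - 2 * (p s : ℂ) * y s 1) t =
      (lam - (q t : ℂ)) * y t 0 - 2 * deriv (fun s => (p s : ℂ) * y s 1) t := by
    simp only [mul_assoc]
    exact ((h3 t).sub (hpy.const_mul 2)).deriv
  simp only [iteratedDeriv_succ, iteratedDeriv_zero, e0, e1, e2, e3]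
  ring

theorem eq_zero_of_hasDerivAt_coeffMat {p q : ℝ → ℝ} {lam : ℂ} {y : ℝ → Fin 4 → ℂ}
    (hy : ∀ t, HasDerivAt y (coeffMat p q lam t *ᵥ y t) t) (h : ∀ t, y t 0 = 0) : y = 0 := by
  simp only [hasDerivAt_coeffMat_iff, forall_and] at hy
  obtain ⟨h0, h1, h2, -⟩ := hy
  have deriv_zero {g g' : ℝ → ℂ} (hg : ∀ t, HasDerivAt g (g' t) t) (hz : ∀ t, g t = 0) (t : ℝ) :
      g' t = 0 := by
    rw [← (hg t).deriv, funext hz, deriv_const]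
  have z1 := deriv_zero h0 h
  have z2 := deriv_zero h1 z1
  have z3 := deriv_zero h2 z2
  simp only [z1, mul_zero, sub_zero] at z3
  ext t i
  fin_cases i
  exacts [h t, z1 t, z2 t, z3 t]

/-- For continuous 1-periodic `p, q` (`p` continuously differentiable) and `λ ∈ ℂ`,
there is a nonzero 2-periodic solution of `f'''' + 2(pf')' + qf = λf` if and only if
`det(M(1,λ) − I₄)·det(M(1,λ) + I₄) = 0`, where `M(·,λ)` is the fundamental matrix of
`M' = (Λ(λ) − 2pJ − qJ₁)M`, `M(0) = I₄`. -/
theorem two_periodic_eigenvalue_iff_det (p q : ℝ → ℝ)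
    (hp : ContDiff ℝ 1 p) (hq : Continuous q)
    (hpper : ∀ t, p (t + 1) = p t) (hqper : ∀ t, q (t + 1) = q t) (lam : ℂ)
    (M : ℝ → Matrix (Fin 4) (Fin 4) ℂ)
    (hM0 : M 0 = 1)
    (hM : ∀ t : ℝ, ∀ i j : Fin 4,
      HasDerivAt (fun s => M s i j)
        (((LamMat lam - (2 * p t : ℝ) • Jmat - (q t : ℝ) • J1mat) * M t) i j) t) :
    (∃ f : ℝ → ℂ, f ≠ 0 ∧ ContDiff ℝ 4 f ∧
      (∀ t : ℝ, iteratedDeriv 4 f t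
        + 2 * deriv (fun s => (p s : ℂ) * deriv f s) t
        + (q t : ℂ) * f t = lam * f t) ∧
      (∀ t : ℝ, f (t + 2) = f t)) ↔
    (M 1 - 1).det * (M 1 + 1).det = 0 := by
  have hA := continuous_coeffMat hp.continuous hq lam
  have hMv (v : Fin 4 → ℂ) (t : ℝ) :
      HasDerivAt (fun s => M s *ᵥ v) (coeffMat p q lam t *ᵥ (M t *ᵥ v)) t :=
    hasDerivAt_mulVec_of_entries (A := coeffMat p q lam t) (hM t) v
  have hsol {y : ℝ → Fin 4 → ℂ} (hy : ∀ t, HasDerivAt y (coeffMat p q lam t *ᵥ y t) t) :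
      y = fun t => M t *ᵥ y 0 :=
    linearODE_unique (t₀ := 0) hA hy (hMv _) (by simp [hM0])
  have hshift (v : Fin 4 → ℂ) (t : ℝ) : M (t + 1) *ᵥ v = M t *ᵥ (M 1 *ᵥ v) := by
    have hper (s : ℝ) : coeffMat p q lam (s + 1) = coeffMat p q lam s := by
      simp only [coeffMat, hpper, hqper]
    have := hsol (y := fun s => M (s + 1) *ᵥ v) fun s => by
      rw [← hper]
      exact (hMv v (s + 1)).comp_add_const s 1
    simpa using congrFun this t
  have hshift_two (v : Fin 4 → ℂ) (t : ℝ) : M (t + 2) *ᵥ v = M t *ᵥ (M 1 *ᵥ (M 1 *ᵥ v)) := by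
    rw [← hshift, ← hshift, add_assoc, one_add_one_eq_two]
  rw [det_sub_one_mul_det_add_one_eq_zero_iff]
  constructor
  · rintro ⟨f, hf0, hf, heq, hfper⟩
    have hy := hsol (hasDerivAt_quasiDeriv hp hf heq)
    refine ⟨quasiDeriv p f 0, fun h0 => hf0 ?_, ?_⟩
    · funext t
      have := congrFun (congrFun hy t) 0
      simp only [h0, Matrix.mulVec_zero] at this
      simpa [quasiDeriv] using this
    · have h2 := congrFun hy (0 + 2)
      simp only [hshift_two, hM0, Matrix.one_mulVec] at h2
      rw [← h2]
      have hp2 : p (0 + 2) = p 0 := by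
        rw [← one_add_one_eq_two, ← add_assoc, hpper, hpper]
      have f1 := periodic_deriv hfper
      have f2 := periodic_deriv f1
      have f3 := periodic_deriv f2
      simp only [quasiDeriv, hfper, f1, f2, f3, hp2]
  · rintro ⟨v, hv, hvv⟩
    obtain ⟨hf, heq⟩ := solution_of_hasDerivAt_coeffMat hp hq (hMv v)
    refine ⟨fun t => (M t *ᵥ v) 0, fun h0 => hv ?_, hf, heq, fun t => ?_⟩
    · have := congrFun (eq_zero_of_hasDerivAt_coeffMat (hMv v) (congrFun h0)) 0
      simpa [hM0] using this
    · simp only [hshift_two, hvv]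
end
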